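/- Let K, T, S be positive integers with S ≤ T, let η > 0, let ℓ_1, …, ℓ_T ∈ [0,1]^K, and set ℓ_0 = (0,…,0). Let w̃_1 be any element of the clipped simplex Δ̃_K, and for each t ∈ {1,…,T} define w_t = the minimizer over Δ̃_K of w ↦ ⟨w, ηℓ_{t−1}⟩ + D_φ(w‖w̃_t) and w̃_{t+1} = the minimizer over Δ̃_K of w ↦ ⟨w, ηℓ_t⟩ + D_φ(w‖w̃_t). Then for every comparator sequence (E_1,…,E_T) ∈ [K]^T with at most S−1 switches, ∑_{t=1}^T ⟨w_t, ℓ_t⟩ − ∑_{t=1}^T ℓ_t[E_t] ≤ η·∑_{t=1}^T ‖ℓ_t − ℓ_{t−1}‖_∞² + (S·log(KT/S))/η + S. -/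

import Mathlib

open Finset

/-- The probability simplex in `ℝ^K`. -/
def stdSimplex' (K : ℕ) : Set (Fin K → ℝ) :=
  {w | (∀ i, 0 ≤ w i) ∧ ∑ i, w i = 1}

/-- The clipped simplex `Δ̃_K = {w ∈ Δ_K : w i ≥ S/(TK)}`. -/
def clippedSimplex (K T S : ℕ) : Set (Fin K → ℝ) :=
  {w | w ∈ stdSimplex' K ∧ ∀ i, (S : ℝ) / (T * K) ≤ w i}

/-- The negative Shannon entropy `φ(w) = ∑ i, w i * log (w i)`. -/
noncomputable def negEntropy {K : ℕ} (w : Fin K → ℝ) : ℝ :=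
  ∑ i, w i * Real.log (w i)

/-- The Bregman divergence with respect to the negative Shannon entropy. -/
noncomputable def breg {K : ℕ} (x y : Fin K → ℝ) : ℝ :=
  negEntropy x - negEntropy y - ∑ i, (x i - y i) * (1 + Real.log (y i))

/-- The standard inner product on `ℝ^K`. -/
def ip {K : ℕ} (x y : Fin K → ℝ) : ℝ := ∑ i, x i * y i

theorem breg_eq_sum {K : ℕ} (x y : Fin K → ℝ) :
    breg x y = ∑ i, (x i * (Real.log (x i) - Real.log (y i)) - x i + y i) := by
  simp only [breg, negEntropy, ← Finset.sum_sub_distrib]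
  exact Finset.sum_congr rfl fun i _ => by ring

theorem breg_sub_breg_sub_breg {K : ℕ} (u w y : Fin K → ℝ) :
    breg u y - breg u w - breg w y =
      ∑ i, (u i - w i) * (Real.log (w i) - Real.log (y i)) := by
  simp only [breg_eq_sum, ← Finset.sum_sub_distrib]
  exact Finset.sum_congr rfl fun i _ => by ring

theorem sq_sqrt_sub_sqrt_le {x y : ℝ} (hx : 0 < x) (hy : 0 < y) :
    (√x - √y) ^ 2 ≤ x * (Real.log x - Real.log y) - x + y := by
  have hsx := Real.sqrt_pos.2 hx
  have hsy := Real.sqrt_pos.2 hy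
  have h := Real.log_le_sub_one_of_pos (div_pos hsy hsx)
  rw [Real.log_div hsy.ne' hsx.ne', Real.log_sqrt hx.le, Real.log_sqrt hy.le] at h
  have h2 := mul_le_mul_of_nonneg_left h hx.le
  have h3 : x * (√y / √x - 1) = √x * √y - x := by
    nth_rewrite 1 [← Real.mul_self_sqrt hx.le]
    field_simp
    linarith [Real.mul_self_sqrt hx.le, mul_sub √x √y √x]
  nlinarith [Real.sq_sqrt hx.le, Real.sq_sqrt hy.le]

theorem breg_nonneg {K : ℕ} {x y : Fin K → ℝ} (hx : ∀ i, 0 < x i) (hy : ∀ i, 0 < y i) :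
    0 ≤ breg x y := by
  rw [breg_eq_sum]
  exact Finset.sum_nonneg fun i _ => (sq_nonneg _).trans (sq_sqrt_sub_sqrt_le (hx i) (hy i))

/-- A form of Pinsker's inequality, with the constant obtained through the Hellinger distance. -/
theorem sq_sum_abs_sub_le_four_mul_breg {K : ℕ} {x y : Fin K → ℝ}
    (hx : ∀ i, 0 < x i) (hy : ∀ i, 0 < y i) (hx1 : ∑ i, x i = 1) (hy1 : ∑ i, y i = 1) :
    (∑ i, |x i - y i|) ^ 2 ≤ 4 * breg x y := by
  have h1 : ∑ i, (√(x i) - √(y i)) ^ 2 ≤ breg x y := by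
    rw [breg_eq_sum]
    exact Finset.sum_le_sum fun i _ => sq_sqrt_sub_sqrt_le (hx i) (hy i)
  have h2 : ∑ i, (√(x i) + √(y i)) ^ 2 ≤ 4 := by
    calc ∑ i, (√(x i) + √(y i)) ^ 2 ≤ ∑ i, (2 * x i + 2 * y i) :=
          Finset.sum_le_sum fun i _ => by
            nlinarith [Real.sq_sqrt (hx i).le, Real.sq_sqrt (hy i).le,
              sq_nonneg (√(x i) - √(y i))]
      _ = 4 := by
          rw [Finset.sum_add_distrib, ← Finset.mul_sum, ← Finset.mul_sum, hx1, hy1]; norm_num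
  have h3 : ∑ i, |x i - y i| = ∑ i, |√(x i) - √(y i)| * (√(x i) + √(y i)) :=
    Finset.sum_congr rfl fun i _ => by
      have h : x i - y i = (√(x i) - √(y i)) * (√(x i) + √(y i)) := by
        nlinarith [Real.sq_sqrt (hx i).le, Real.sq_sqrt (hy i).le]
      rw [h, abs_mul, abs_of_nonneg (a := √(x i) + √(y i)) (by positivity)]
  have h4 := Finset.sum_mul_sq_le_sq_mul_sq Finset.univ
    (fun i => |√(x i) - √(y i)|) (fun i => √(x i) + √(y i))
  simp only [sq_abs] at h4
  rw [h3]
  nlinarith [breg_nonneg hx hy,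
    Finset.sum_nonneg fun i (_ : i ∈ Finset.univ) => sq_nonneg (√(x i) - √(y i))]

/-- First-order optimality of a Bregman proximal step over a convex set of positive vectors. -/
theorem sum_sub_mul_nonneg_of_isMinOn {K : ℕ} {C : Set (Fin K → ℝ)} (hC : Convex ℝ C)
    (hpos : ∀ v ∈ C, ∀ i, 0 < v i) {g y w u : Fin K → ℝ} (hw : w ∈ C) (hu : u ∈ C)
    (hmin : ∀ v ∈ C, ip w g + breg w y ≤ ip v g + breg v y) :
    0 ≤ ∑ i, (u i - w i) * (g i + Real.log (w i) - Real.log (y i)) := by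
  have hpt : ∀ s : ℝ, 0 < s → s ≤ 1 →
      0 ≤ ∑ i, (u i - w i) * (g i + Real.log (w i + s * (u i - w i)) - Real.log (y i)) := by
    intro s hs hs1
    have hv : (fun i => w i + s * (u i - w i)) ∈ C := by
      convert hC hw hu (sub_nonneg.2 hs1) hs.le (by ring) using 1
      ext i
      simp only [Pi.add_apply, Pi.smul_apply, smul_eq_mul]
      ring
    have h1 := hmin _ hv
    have h2 := breg_nonneg (hpos w hw) (hpos _ hv)
    have h3 := breg_sub_breg_sub_breg w (fun i => w i + s * (u i - w i)) y
    have h4 : s * ∑ i, (u i - w i) *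
          (g i + Real.log (w i + s * (u i - w i)) - Real.log (y i)) =
        ip (fun i => w i + s * (u i - w i)) g - ip w g -
          ∑ i, (w i - (w i + s * (u i - w i))) *
            (Real.log (w i + s * (u i - w i)) - Real.log (y i)) := by
      simp only [ip, ← Finset.sum_sub_distrib, Finset.mul_sum]
      exact Finset.sum_congr rfl fun i _ => by ring
    refine nonneg_of_mul_nonneg_right (a := s) ?_ hs
    rw [h4, ← h3]
    linarith
  have hlim : Filter.Tendsto
      (fun s : ℝ => ∑ i, (u i - w i) *
        (g i + Real.log (w i + s * (u i - w i)) - Real.log (y i)))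
      (nhdsWithin 0 (Set.Ioi 0))
      (nhds (∑ i, (u i - w i) * (g i + Real.log (w i) - Real.log (y i)))) := by
    refine Filter.Tendsto.mono_left ?_ nhdsWithin_le_nhds
    have hc : ContinuousAt (fun s : ℝ => ∑ i, (u i - w i) *
        (g i + Real.log (w i + s * (u i - w i)) - Real.log (y i))) 0 := by
      refine tendsto_finsetSum _ fun i _ => ?_
      refine ContinuousAt.mul continuousAt_const
        ((continuousAt_const.add (ContinuousAt.log (by fun_prop) ?_)).sub continuousAt_const)
      simpa using (hpos w hw i).ne'
    simpa [ContinuousAt] using hc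
  refine ge_of_tendsto hlim ?_
  filter_upwards [Ioc_mem_nhdsGT (zero_lt_one' ℝ)] with s hs using hpt s hs.1 hs.2

theorem ip_sub_ip_le_breg {K : ℕ} {C : Set (Fin K → ℝ)} (hC : Convex ℝ C)
    (hpos : ∀ v ∈ C, ∀ i, 0 < v i) {g y w u : Fin K → ℝ} (hw : w ∈ C) (hu : u ∈ C)
    (hmin : ∀ v ∈ C, ip w g + breg w y ≤ ip v g + breg v y) :
    ip w g - ip u g ≤ breg u y - breg u w - breg w y := by
  have h := sum_sub_mul_nonneg_of_isMinOn hC hpos hw hu hmin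
  rw [breg_sub_breg_sub_breg, ← sub_nonneg]
  refine h.trans_eq ?_
  simp only [ip, ← Finset.sum_sub_distrib]
  exact Finset.sum_congr rfl fun i _ => by ring

/-- One round of optimistic mirror descent with entropic regularizer. -/
theorem optimistic_step_regret_le {K : ℕ} {C : Set (Fin K → ℝ)} (hC : Convex ℝ C)
    (hpos : ∀ v ∈ C, ∀ i, 0 < v i) (hsum : ∀ v ∈ C, ∑ i, v i = 1) {η : ℝ} (hη : 0 < η)
    {m l y w z u : Fin K → ℝ} (hy : y ∈ C) (hw : w ∈ C) (hz : z ∈ C) (hu : u ∈ C)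
    (hminw : ∀ v ∈ C, ip w (η • m) + breg w y ≤ ip v (η • m) + breg v y)
    (hminz : ∀ v ∈ C, ip z (η • l) + breg z y ≤ ip v (η • l) + breg v y) :
    η * (ip w l - ip u l) ≤ η ^ 2 * ‖l - m‖ ^ 2 + (breg u y - breg u z) := by
  have h1 := ip_sub_ip_le_breg hC hpos hw hz hminw
  have h2 := ip_sub_ip_le_breg hC hpos hz hu hminz
  have h3 := breg_nonneg (hpos w hw) (hpos y hy)
  have h4 := sq_sum_abs_sub_le_four_mul_breg (hpos z hz) (hpos w hw) (hsum z hz) (hsum w hw)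
  have h5 : ip w l - ip z l - (ip w m - ip z m) ≤ (∑ i, |z i - w i|) * ‖l - m‖ := by
    simp only [ip, ← Finset.sum_sub_distrib, Finset.sum_mul]
    refine Finset.sum_le_sum fun i _ => ?_
    calc w i * l i - z i * l i - (w i * m i - z i * m i) = -((z i - w i) * (l - m) i) := by
          simp only [Pi.sub_apply]; ring
      _ ≤ |(z i - w i) * (l - m) i| := neg_le_abs _
      _ = |z i - w i| * |(l - m) i| := abs_mul _ _
      _ ≤ |z i - w i| * ‖l - m‖ :=
          mul_le_mul_of_nonneg_left (norm_le_pi_norm (l - m) i) (abs_nonneg _)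
  have hip : ∀ a b : Fin K → ℝ, ip a (η • b) = η * ip a b := fun a b => by
    simp only [ip, Pi.smul_apply, smul_eq_mul, Finset.mul_sum]
    exact Finset.sum_congr rfl fun i _ => by ring
  simp only [hip] at h1 h2
  have h6 := mul_le_mul_of_nonneg_left h5 hη.le
  nlinarith [sq_nonneg ((∑ i, |z i - w i|) / 2 - η * ‖l - m‖)]

theorem convex_clippedSimplex (K T S : ℕ) : Convex ℝ (clippedSimplex K T S) := by
  rintro x ⟨⟨hx0, hx1⟩, hx2⟩ y ⟨⟨hy0, hy1⟩, hy2⟩ a b ha hb hab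
  refine ⟨⟨fun i => ?_, ?_⟩, fun i => ?_⟩
  · have := hx0 i
    have := hy0 i
    simp only [Pi.add_apply, Pi.smul_apply, smul_eq_mul]
    positivity
  · simp only [Pi.add_apply, Pi.smul_apply, smul_eq_mul, Finset.sum_add_distrib,
      ← Finset.mul_sum, hx1, hy1]
    linarith
  · simp only [Pi.add_apply, Pi.smul_apply, smul_eq_mul]
    calc (S : ℝ) / (T * K) = a * (S / (T * K)) + b * (S / (T * K)) := by
          rw [← add_mul, hab, one_mul]
      _ ≤ a * x i + b * y i :=
          add_le_add (mul_le_mul_of_nonneg_left (hx2 i) ha) (mul_le_mul_of_nonneg_left (hy2 i) hb)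

/-- The vertex `e_j` of the simplex, mixed with the uniform distribution. -/
noncomputable def clippedVertex (K T S : ℕ) (j i : Fin K) : ℝ :=
  (1 - (S : ℝ) / T) * (if i = j then 1 else 0) + S / (T * K)

theorem clippedVertex_mem {K T S : ℕ} (hK : 0 < K) (hT : 0 < T) (hST : S ≤ T) (j : Fin K) :
    clippedVertex K T S j ∈ clippedSimplex K T S := by
  have hT' : (0 : ℝ) < T := Nat.cast_pos.2 hT
  have hK' : (0 : ℝ) < K := Nat.cast_pos.2 hK
  have h1 : (0 : ℝ) ≤ 1 - (S : ℝ) / T :=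
    sub_nonneg.2 (div_le_one_of_le₀ (Nat.cast_le.2 hST) hT'.le)
  have h2 : ∀ i, (0 : ℝ) ≤ (1 - (S : ℝ) / T) * (if i = j then 1 else 0) := fun i =>
    mul_nonneg h1 (by split_ifs <;> norm_num)
  refine ⟨⟨fun i => add_nonneg (h2 i) (by positivity), ?_⟩,
    fun i => le_add_of_nonneg_left (h2 i)⟩
  simp only [clippedVertex, Finset.sum_add_distrib, ← Finset.mul_sum, Finset.sum_ite_eq',
    Finset.mem_univ, if_true, Finset.sum_const, Finset.card_univ, Fintype.card_fin, nsmul_eq_mul]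
  field_simp
  ring

theorem ip_clippedVertex_le {K T S : ℕ} (hK : 0 < K) (hT : 0 < T) (j : Fin K)
    {l : Fin K → ℝ} (hl : ∀ i, l i ∈ Set.Icc (0 : ℝ) 1) :
    ip (clippedVertex K T S j) l ≤ l j + S / T := by
  have hT' : (0 : ℝ) < T := Nat.cast_pos.2 hT
  have hK' : (0 : ℝ) < K := Nat.cast_pos.2 hK
  have h1 : ip (clippedVertex K T S j) l =
      (1 - (S : ℝ) / T) * l j + S / (T * K) * ∑ i, l i := by
    simp only [ip, clippedVertex, add_mul, Finset.sum_add_distrib, mul_assoc, ite_mul, one_mul,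
      zero_mul, ← Finset.mul_sum, Finset.sum_ite_eq', Finset.mem_univ, if_true]
  have h2 : ∑ i, l i ≤ K := by
    simpa using Finset.sum_le_sum fun i (_ : i ∈ Finset.univ) => (hl i).2
  have h3 : (S : ℝ) / (T * K) * ∑ i, l i ≤ S / (T * K) * K :=
    mul_le_mul_of_nonneg_left h2 (by positivity)
  have h4 : (S : ℝ) / (T * K) * K = S / T := by field_simp
  have h5 : 0 ≤ (S : ℝ) / T * l j := mul_nonneg (by positivity) (hl j).1
  rw [h1]
  linarith

theorem breg_sub_breg_eq {K : ℕ} {u y z : Fin K → ℝ} (h : ∑ i, y i = ∑ i, z i) :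
    breg u y - breg u z = ip u (fun i => Real.log (z i)) - ip u (fun i => Real.log (y i)) := by
  simp only [breg_eq_sum, ip, Finset.sum_add_distrib, Finset.sum_sub_distrib, mul_sub, h]
  ring

/-- Telescoping along a sequence that changes only at the indices counted on the right. -/
theorem sum_sub_le_mul_card_switches {α : Type*} [DecidableEq α] (E : ℕ → α) (F : α → ℕ → ℝ)
    {L : ℝ} {T : ℕ} (hT : 1 ≤ T) (hL : ∀ a, ∀ t ∈ Finset.Icc 1 (T + 1), -L ≤ F a t)
    (h0 : ∀ a, ∀ t ∈ Finset.Icc 1 (T + 1), F a t ≤ 0) :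
    ∑ t ∈ Finset.Icc 1 T, (F (E t) (t + 1) - F (E t) t) ≤
      L * (((Finset.Icc 2 T).filter (fun t => E t ≠ E (t - 1))).card + 1) := by
  have key : ∀ n, 1 ≤ n → n ≤ T →
      ∑ t ∈ Finset.Icc 1 n, (F (E t) (t + 1) - F (E t) t) ≤ F (E n) (n + 1) +
        L * (((Finset.Icc 2 n).filter (fun t => E t ≠ E (t - 1))).card + 1) := by
    intro n hn
    induction n, hn using Nat.le_induction with
    | base =>
      intro _
      have := hL (E 1) 1 (by simp)
      simp
      linarith
    | succ n hn ih =>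
      intro hnT
      have h1 := ih (by omega)
      have hlow := hL (E (n + 1)) (n + 1) (by simp; omega)
      have hup := h0 (E n) (n + 1) (by simp; omega)
      rw [Finset.sum_Icc_succ_top (by omega), ← Finset.insert_Icc_right_eq_Icc_add_one (by omega),
        Finset.filter_insert]
      by_cases hEq : E (n + 1) = E n
      · rw [if_neg (by simpa using hEq), hEq]
        linarith
      · rw [if_pos (by simpa using hEq), Finset.card_insert_of_notMem (by simp)]
        push_cast
        linarith
  have h1 := key T hT le_rfl
  have h2 := h0 (E T) (T + 1) (by simp)
  linarith

theorem ocs_path_length_tracking_regret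
    (K T S : ℕ) (hK : 0 < K) (hT : 0 < T) (hS : 0 < S) (hST : S ≤ T)
    (η : ℝ) (hη : 0 < η)
    (ℓ : ℕ → Fin K → ℝ) (hℓ0 : ℓ 0 = 0)
    (hℓ : ∀ t ∈ Finset.Icc 1 T, ∀ i, ℓ t i ∈ Set.Icc (0 : ℝ) 1)
    (w wt : ℕ → Fin K → ℝ)
    (hwt1 : wt 1 ∈ clippedSimplex K T S)
    (hminw : ∀ t ∈ Finset.Icc 1 T,
      w t ∈ clippedSimplex K T S ∧
      ∀ v ∈ clippedSimplex K T S,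
        ip (w t) (η • ℓ (t - 1)) + breg (w t) (wt t)
          ≤ ip v (η • ℓ (t - 1)) + breg v (wt t))
    (hminwt : ∀ t ∈ Finset.Icc 1 T,
      wt (t + 1) ∈ clippedSimplex K T S ∧
      ∀ v ∈ clippedSimplex K T S,
        ip (wt (t + 1)) (η • ℓ t) + breg (wt (t + 1)) (wt t)
          ≤ ip v (η • ℓ t) + breg v (wt t))
    (E : ℕ → Fin K)
    (hE : ((Finset.Icc 2 T).filter (fun t => E t ≠ E (t - 1))).card ≤ S - 1) :
    ∑ t ∈ Finset.Icc 1 T, ip (w t) (ℓ t) - ∑ t ∈ Finset.Icc 1 T, ℓ t (E t)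
      ≤ η * ∑ t ∈ Finset.Icc 1 T, ‖ℓ t - ℓ (t - 1)‖ ^ 2
        + S * Real.log (K * T / S) / η + S := by
  have hT' : (0 : ℝ) < T := Nat.cast_pos.2 hT
  have hK' : (0 : ℝ) < K := Nat.cast_pos.2 hK
  have hS' : (0 : ℝ) < S := Nat.cast_pos.2 hS
  have hγ : (0 : ℝ) < S / (T * K) := by positivity
  have hpos : ∀ v ∈ clippedSimplex K T S, ∀ i, 0 < v i := fun v hv i => hγ.trans_le (hv.2 i)
  have hsum : ∀ v ∈ clippedSimplex K T S, ∑ i, v i = 1 := fun v hv => hv.1.2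
  have hwt : ∀ t ∈ Finset.Icc 1 (T + 1), wt t ∈ clippedSimplex K T S := by
    intro t ht
    rw [Finset.mem_Icc] at ht
    rcases ht.1.eq_or_lt with rfl | h
    · exact hwt1
    · have := (hminwt (t - 1) (Finset.mem_Icc.2 (by omega))).1
      rwa [Nat.sub_add_cancel ht.1] at this
  set u := clippedVertex K T S with hu_def
  have hu : ∀ j, u j ∈ clippedSimplex K T S := clippedVertex_mem hK hT hST
  set L := Real.log (K * T / S) with hL_def
  have hγL : Real.log ((S : ℝ) / (T * K)) = -L := by
    rw [hL_def, ← Real.log_inv, inv_div, mul_comm (T : ℝ)]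
  set F : Fin K → ℕ → ℝ := fun j t => ip (u j) (fun i => Real.log (wt t i)) with hF
  have hFL : ∀ a, ∀ t ∈ Finset.Icc 1 (T + 1), -L ≤ F a t := by
    intro a t ht
    calc -L = ∑ i, u a i * -L := by rw [← Finset.sum_mul, hsum _ (hu a), one_mul]
      _ ≤ F a t := Finset.sum_le_sum fun i _ => mul_le_mul_of_nonneg_left
          (hγL ▸ Real.log_le_log hγ ((hwt t ht).2 i)) (hpos _ (hu a) i).le
  have hF0 : ∀ a, ∀ t ∈ Finset.Icc 1 (T + 1), F a t ≤ 0 := by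
    intro a t ht
    refine Finset.sum_nonpos fun i _ => mul_nonpos_of_nonneg_of_nonpos (hpos _ (hu a) i).le
      (Real.log_nonpos (hpos _ (hwt t ht) i).le ?_)
    rw [← hsum _ (hwt t ht)]
    exact Finset.single_le_sum (fun j _ => (hpos _ (hwt t ht) j).le) (Finset.mem_univ i)
  have hL0 : 0 ≤ L := by
    have h1 := hFL (E 1) 1 (by simp)
    have h2 := hF0 (E 1) 1 (by simp)
    linarith
  have htel : ∑ t ∈ Finset.Icc 1 T, (F (E t) (t + 1) - F (E t) t) ≤ S * L := by
    refine (sum_sub_le_mul_card_switches E F hT hFL hF0).trans ?_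
    rw [mul_comm]
    refine mul_le_mul_of_nonneg_right ?_ hL0
    exact_mod_cast (by omega :
      ((Finset.Icc 2 T).filter (fun t => E t ≠ E (t - 1))).card + 1 ≤ S)
  have hstep : ∀ t ∈ Finset.Icc 1 T, ip (w t) (ℓ t) - ℓ t (E t) ≤
      η * ‖ℓ t - ℓ (t - 1)‖ ^ 2 + (F (E t) (t + 1) - F (E t) t) / η + S / T := by
    intro t ht
    have ht' := Finset.mem_Icc.1 ht
    have hy := hwt t (Finset.mem_Icc.2 (by omega))
    have hz := (hminwt t ht).1
    have h1 := optimistic_step_regret_le (convex_clippedSimplex K T S) hpos hsum hη hy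
      (hminw t ht).1 hz (hu (E t)) (hminw t ht).2 (hminwt t ht).2
    rw [breg_sub_breg_eq ((hsum _ hy).trans (hsum _ hz).symm)] at h1
    have h2 := ip_clippedVertex_le (S := S) hK hT (E t) (hℓ t ht)
    have h3 : ip (w t) (ℓ t) - ip (u (E t)) (ℓ t) ≤
        η * ‖ℓ t - ℓ (t - 1)‖ ^ 2 + (F (E t) (t + 1) - F (E t) t) / η := by
      refine le_of_mul_le_mul_left (h1.trans_eq ?_) hη
      field_simp
      rfl
    linarith
  calc _ = ∑ t ∈ Finset.Icc 1 T, (ip (w t) (ℓ t) - ℓ t (E t)) :=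
        (Finset.sum_sub_distrib _ _).symm
    _ ≤ _ := Finset.sum_le_sum hstep
    _ = η * ∑ t ∈ Finset.Icc 1 T, ‖ℓ t - ℓ (t - 1)‖ ^ 2 +
        (∑ t ∈ Finset.Icc 1 T, (F (E t) (t + 1) - F (E t) t)) / η + S := by
      rw [Finset.sum_add_distrib, Finset.sum_add_distrib, ← Finset.mul_sum, ← Finset.sum_div]
      simp only [Finset.sum_const, Nat.card_Icc, Nat.add_sub_cancel, nsmul_eq_mul]
      field_simp
    _ ≤ _ := by gcongr
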